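/- Let H be an r×s complex matrix with r ≥ s ≥ 1 such that H*H is invertible and such that, writing H_{:,−s} for H with its last column removed, (H_{:,−s})*(H_{:,−s}) is invertible. Let H† = (H*H)⁻¹H* and (H_{:,−s})† = ((H_{:,−s})*(H_{:,−s}))⁻¹(H_{:,−s})* denote the Moore–Penrose pseudoinverses (valid by full column rank). Then H† − ((H*H)⁻¹ eₛ eₛ* H†) / [(H*H)⁻¹]_{s,s} equals the s×r matrix whose first s−1 rows are (H_{:,−s})† and whose last row is zero, where eₛ is the s-th standard basis vector of ℂ^s. -/

import Mathlib

open Matrix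

/-- The `(s+1) × r` matrix whose first `s` rows are those of `M` and whose last
row is zero. -/
def extendRowZero {r s : ℕ} (M : Matrix (Fin s) (Fin r) ℂ) :
    Matrix (Fin (s + 1)) (Fin r) ℂ :=
  Matrix.of fun i j => if h : (i : ℕ) < s then M ⟨i, h⟩ j else 0

/-- If an invertible matrix has an invertible leading principal block of corank one, the
last diagonal entry of its inverse is nonzero. -/
theorem inv_last_last_ne_zero {K : Type*} [Field K] {s : ℕ}
    {G : Matrix (Fin (s + 1)) (Fin (s + 1)) K} (hG : IsUnit G)
    (hG₀ : IsUnit (G.submatrix Fin.castSucc Fin.castSucc)) :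
    G⁻¹ (Fin.last s) (Fin.last s) ≠ 0 := by
  intro hzero
  have hmul : G * G⁻¹ = 1 := mul_nonsing_inv G ((isUnit_iff_isUnit_det G).1 hG)
  have hcol : G.submatrix Fin.castSucc Fin.castSucc *ᵥ
      (fun i => G⁻¹ (Fin.castSucc i) (Fin.last s)) = 0 := by
    ext i
    have h := congrFun (congrFun hmul (Fin.castSucc i)) (Fin.last s)
    rw [mul_apply, Fin.sum_univ_castSucc, hzero, mul_zero, add_zero,
      one_apply_ne (Fin.castSucc_lt_last i).ne] at h
    exact h
  have hcol' := mulVec_injective_of_isUnit hG₀ (hcol.trans (mulVec_zero _).symm)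
  have h := congrFun (congrFun hmul (Fin.last s)) (Fin.last s)
  rw [mul_apply, Fin.sum_univ_castSucc, hzero, mul_zero, add_zero, one_apply_eq] at h
  refine zero_ne_one ((Finset.sum_eq_zero fun i _ => ?_).symm.trans h)
  rw [show G⁻¹ (Fin.castSucc i) (Fin.last s) = 0 from congrFun hcol' i, mul_zero]

/-- Eliminating the last row of `G⁻¹ * A` with the last column of `G⁻¹` leaves the solution
of the system restricted to the leading principal block of `G`. -/
theorem inv_mul_sub_vecMulVec_last {r s : ℕ}
    {G : Matrix (Fin (s + 1)) (Fin (s + 1)) ℂ} (hG : IsUnit G)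
    (hG₀ : IsUnit (G.submatrix Fin.castSucc Fin.castSucc))
    (A : Matrix (Fin (s + 1)) (Fin r) ℂ) :
    G⁻¹ * A - (G⁻¹ (Fin.last s) (Fin.last s))⁻¹ •
        vecMulVec (fun i => G⁻¹ i (Fin.last s)) (fun k => (G⁻¹ * A) (Fin.last s) k)
      = extendRowZero
          ((G.submatrix Fin.castSucc Fin.castSucc)⁻¹ * A.submatrix Fin.castSucc id) := by
  have hβ := inv_last_last_ne_zero hG hG₀
  have hmul : G * G⁻¹ = 1 := mul_nonsing_inv G ((isUnit_iff_isUnit_det G).1 hG)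
  set P := G⁻¹ * A - (G⁻¹ (Fin.last s) (Fin.last s))⁻¹ •
    vecMulVec (fun i => G⁻¹ i (Fin.last s)) (fun k => (G⁻¹ * A) (Fin.last s) k) with hP
  have hlast : ∀ k, P (Fin.last s) k = 0 := by
    intro k
    simp only [hP, Matrix.sub_apply, Matrix.smul_apply, vecMulVec_apply, smul_eq_mul]
    rw [inv_mul_cancel_left₀ hβ, sub_self]
  have hcol : G *ᵥ (fun i => G⁻¹ i (Fin.last s)) = fun i => (1 : Matrix _ _ ℂ) i (Fin.last s) := by
    rw [← hmul]
    rfl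
  have hGP : G.submatrix Fin.castSucc Fin.castSucc * P.submatrix Fin.castSucc id =
      A.submatrix Fin.castSucc id := by
    ext i k
    have h : (G * P) (Fin.castSucc i) k = A (Fin.castSucc i) k := by
      rw [hP, Matrix.mul_sub, ← Matrix.mul_assoc, hmul, Matrix.one_mul, Matrix.mul_smul, mul_vecMulVec, hcol,
        Matrix.sub_apply, Matrix.smul_apply, vecMulVec_apply, one_apply_ne (Fin.castSucc_lt_last i).ne,
        zero_mul, smul_zero, sub_zero]
    rw [mul_apply, Fin.sum_univ_castSucc, hlast, mul_zero, add_zero] at h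
    exact h
  rw [← hGP, nonsing_inv_mul_cancel_left _ _ ((isUnit_iff_isUnit_det _).1 hG₀)]
  ext i k
  induction i using Fin.lastCases with
  | last => simp [extendRowZero, hlast]
  | cast i => simp [extendRowZero]

/-- For a tall matrix `H` of full column rank (so `H† = (H*H)⁻¹H*`), the
pseudoinverse downdating formula
`H† - ((H*H)⁻¹ eₛ eₛ* H†)/[(H*H)⁻¹]_{s,s} = [ (H_{:,-s})† ; 0 ]` holds, where the
right-hand side is the matrix whose first `s-1` rows are `(H_{:,-s})†` and whose
last row is zero. -/
theorem pinv_deflation (r s : ℕ) (hrs : s + 1 ≤ r)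
    (H : Matrix (Fin r) (Fin (s + 1)) ℂ)
    (hH : IsUnit (Hᴴ * H))
    (hHbar : IsUnit ((H.submatrix id Fin.castSucc)ᴴ * H.submatrix id Fin.castSucc)) :
    (Hᴴ * H)⁻¹ * Hᴴ - ((Hᴴ * H)⁻¹ (Fin.last s) (Fin.last s))⁻¹ •
        Matrix.vecMulVec (fun i => (Hᴴ * H)⁻¹ i (Fin.last s))
          (fun k => ((Hᴴ * H)⁻¹ * Hᴴ) (Fin.last s) k)
      = extendRowZero
          (((H.submatrix id Fin.castSucc)ᴴ * H.submatrix id Fin.castSucc)⁻¹ *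
            (H.submatrix id Fin.castSucc)ᴴ) := by
  exact inv_mul_sub_vecMulVec_last hH hHbar Hᴴ
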